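/- arXiv:1308.4049 — 2 statements merged into one kernel-verified Lean document; each statement's English description precedes it below -/
import Mathlib

section
/- Along any continuous-time fictitious play orbit in a bimatrix game (A,B), the difference between the time-averaged realized payoff and the current best-response payoff vanishes: lim_{T→∞} ( (1/T)∫_0^T x(t)·A·y(t) dt − Ā(q(T)) ) = 0 and lim_{T→∞} ( (1/T)∫_0^T x(t)·B·y(t) dt − B̄(p(T)) ) = 0. -/
open Filter
open scoped BigOperators Topology

/-- Maximal entry of the vector `A q`: player A's best payoff against `q`. -/
noncomputable def Abar {m n : ℕ} (A : Matrix (Fin (m + 1)) (Fin (n + 1)) ℝ)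
    (q : Fin (n + 1) → ℝ) : ℝ :=
  Finset.univ.sup' Finset.univ_nonempty (fun i => ∑ j, A i j * q j)

/-- Maximal entry of the vector `p B`: player B's best payoff against `p`. -/
noncomputable def Bbar {m n : ℕ} (B : Matrix (Fin (m + 1)) (Fin (n + 1)) ℝ)
    (p : Fin (m + 1) → ℝ) : ℝ :=
  Finset.univ.sup' Finset.univ_nonempty (fun j => ∑ i, p i * B i j)

lemma fp_core {N : ℕ} (g w : ℝ → Fin (N + 1) → ℝ) (C : ℝ)
    (hg : ∀ i, Measurable (fun t => g t i)) (hw : ∀ i, Measurable (fun t => w t i))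
    (hC : ∀ t i, |g t i| ≤ C) (hws : ∀ t, w t ∈ stdSimplex ℝ (Fin (N + 1)))
    (hBR : ∀ t ≥ (1:ℝ), ∀ i, ∫ s in (0:ℝ)..t, g s i ≤ ∑ k, w t k * ∫ s in (0:ℝ)..t, g s k) :
    Tendsto (fun T : ℝ => (1 / T) * (∫ t in (0:ℝ)..T, ∑ i, w t i * g t i) -
      (1 / T) * Finset.univ.sup' Finset.univ_nonempty (fun i => ∫ s in (0:ℝ)..T, g s i))
      atTop (𝓝 0) := by
  have hC0 : 0 ≤ C := (abs_nonneg _).trans (hC 0 0)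
  have hint : ∀ (f : ℝ → ℝ), Measurable f → (∀ t, |f t| ≤ C) → ∀ a b,
      IntervalIntegrable f MeasureTheory.volume a b := by
    intro f hf hb a b
    refine (intervalIntegrable_const (c := C)).mono_fun hf.aestronglyMeasurable ?_
    refine Eventually.of_forall fun t => ?_
    simpa [abs_of_nonneg hC0] using hb t
  have hgi : ∀ i a b, IntervalIntegrable (fun t => g t i) MeasureTheory.volume a b :=
    fun i => hint _ (hg i) (fun t => hC t i)
  set h : ℝ → ℝ := fun t => ∑ i, w t i * g t i with hh
  have hhi : ∀ a b, IntervalIntegrable h MeasureTheory.volume a b := by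
    refine hint h ?_ ?_
    · exact Finset.measurable_sum _ fun i _ => (hw i).mul (hg i)
    · intro t
      calc |h t| ≤ ∑ i, |w t i * g t i| := Finset.abs_sum_le_sum_abs _ _
        _ ≤ ∑ i, w t i * C := by
            refine Finset.sum_le_sum fun i _ => ?_
            rw [abs_mul, abs_of_nonneg ((hws t).1 i)]
            exact mul_le_mul_of_nonneg_left (hC t i) ((hws t).1 i)
        _ = C := by rw [← Finset.sum_mul, (hws t).2, one_mul]
  set G : Fin (N + 1) → ℝ → ℝ := fun i t => ∫ s in (0:ℝ)..t, g s i with hG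
  set M : ℝ → ℝ := fun t => Finset.univ.sup' Finset.univ_nonempty (fun i => G i t) with hM
  have hGM : ∀ i t, G i t ≤ M t := fun i t =>
    Finset.le_sup' (fun i => G i t) (Finset.mem_univ i)
  have hGL : ∀ i s t, G i s ≤ G i t + C * |s - t| := by
    intro i s t
    have h1 : G i s - G i t = ∫ u in t..s, g u i :=
      intervalIntegral.integral_interval_sub_left (hgi i _ _) (hgi i _ _)
    have h2 : ‖∫ u in t..s, g u i‖ ≤ C * |s - t| :=
      intervalIntegral.norm_integral_le_of_norm_le_const fun u _ => hC u i
    have := le_abs_self (∫ u in t..s, g u i)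
    rw [Real.norm_eq_abs] at h2
    linarith
  have hML : LipschitzWith C.toNNReal M := by
    refine LipschitzWith.of_le_add_mul _ fun s t => ?_
    rw [Real.coe_toNNReal _ hC0, Real.dist_eq]
    refine Finset.sup'_le _ _ fun i _ => ?_
    linarith [hGL i s t, hGM i t]
  have hder : ∀ᵐ t, 1 ≤ t → deriv M t = h t := by
    have hGd : ∀ᵐ t, ∀ i, HasDerivAt (G i) (g t i) t := by
      rw [MeasureTheory.ae_all_iff]
      intro i
      have hl : MeasureTheory.LocallyIntegrable (fun t => g t i) MeasureTheory.volume := by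
        refine (MeasureTheory.locallyIntegrable_const C).mono (hg i).aestronglyMeasurable ?_
        refine Eventually.of_forall fun t => ?_
        simpa [abs_of_nonneg hC0] using hC t i
      filter_upwards [LocallyIntegrable.ae_hasDerivAt_integral hl] with t ht
      exact ht 0
    filter_upwards [hGd, hML.ae_differentiableAt_real] with t htG htM ht1
    have hS : HasDerivAt (fun s => ∑ k, w t k * G k s) (h t) t :=
      HasDerivAt.fun_sum fun k _ => (htG k).const_mul (w t k)
    have hle : ∀ s, ∑ k, w t k * G k s ≤ M s := by
      intro s
      calc _ ≤ ∑ k, w t k * M s := Finset.sum_le_sum fun k _ =>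
            mul_le_mul_of_nonneg_left (hGM k s) ((hws t).1 k)
        _ = M s := by rw [← Finset.sum_mul, (hws t).2, one_mul]
    have hge : M t ≤ ∑ k, w t k * G k t := Finset.sup'_le _ _ fun i _ => hBR t ht1 i
    have hmin : IsLocalMin (fun s => M s - ∑ k, w t k * G k s) t := by
      refine Eventually.of_forall fun s => ?_
      show M t - _ ≤ M s - _
      linarith [hle s]
    have := hmin.hasDerivAt_eq_zero (htM.hasDerivAt.sub hS)
    linarith
  have hkey : ∀ T ≥ (1:ℝ), ∫ t in (1:ℝ)..T, h t = M T - M 1 := by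
    intro T hT
    rw [← (hML.lipschitzOnWith (s := Set.uIcc 1 T)).absolutelyContinuousOnInterval.integral_deriv_eq_sub]
    refine intervalIntegral.integral_congr_ae ?_
    filter_upwards [hder] with t ht htm
    rw [Set.uIoc_of_le hT] at htm
    exact (ht htm.1.le).symm
  have hlim : Tendsto (fun T : ℝ => (1 / T) * ((∫ t in (0:ℝ)..1, h t) - M 1)) atTop (𝓝 0) := by
    simpa using (tendsto_inv_atTop_zero (𝕜 := ℝ)).mul_const ((∫ t in (0:ℝ)..1, h t) - M 1)
  refine hlim.congr' ?_
  filter_upwards [eventually_ge_atTop (1:ℝ)] with T hT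
  have := intervalIntegral.integral_add_adjacent_intervals (hhi 0 1) (hhi 1 T)
  rw [← this, hkey T hT]
  ring

/-- One player's statement: `w` plays best response to the average of `y`. -/
lemma fp_player {m n : ℕ} (A : Matrix (Fin (m + 1)) (Fin (n + 1)) ℝ)
    (x : ℝ → Fin (m + 1) → ℝ) (y : ℝ → Fin (n + 1) → ℝ)
    (hxmeas : Measurable x) (hymeas : Measurable y)
    (hx : ∀ t, x t ∈ stdSimplex ℝ (Fin (m + 1)))
    (hy : ∀ t, y t ∈ stdSimplex ℝ (Fin (n + 1)))
    (q : ℝ → Fin (n + 1) → ℝ)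
    (hq : ∀ t > (0:ℝ), q t = (1 / t) • ∫ s in (0:ℝ)..t, y s)
    (hBRA : ∀ t ≥ (1:ℝ), ∀ p' ∈ stdSimplex ℝ (Fin (m + 1)),
      ∑ i, ∑ j, p' i * A i j * q t j ≤ ∑ i, ∑ j, x t i * A i j * q t j) :
    Tendsto (fun T : ℝ =>
        (1 / T) * (∫ t in (0:ℝ)..T, ∑ i, ∑ j, x t i * A i j * y t j) - Abar A (q T))
      atTop (𝓝 0) := by
  have hy1 : ∀ t j, |y t j| ≤ 1 := by
    intro t j
    rw [abs_of_nonneg ((hy t).1 j), ← (hy t).2]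
    exact Finset.single_le_sum (fun k _ => (hy t).1 k) (Finset.mem_univ j)
  have hyi : ∀ a b, IntervalIntegrable y MeasureTheory.volume a b := by
    intro a b
    refine (intervalIntegrable_const (c := (1:ℝ))).mono_fun hymeas.aestronglyMeasurable ?_
    refine Eventually.of_forall fun t => ?_
    rw [norm_one]
    exact (pi_norm_le_iff_of_nonneg zero_le_one).2 fun j => hy1 t j
  have hyji : ∀ j a b, IntervalIntegrable (fun t => y t j) MeasureTheory.volume a b := by
    intro j a b
    refine (intervalIntegrable_const (c := (1:ℝ))).mono_fun
      ((measurable_pi_apply j).comp hymeas).aestronglyMeasurable ?_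
    refine Eventually.of_forall fun t => ?_
    rw [norm_one]
    exact hy1 t j
  have hqj : ∀ t > (0:ℝ), ∀ j, q t j = (1 / t) * ∫ s in (0:ℝ)..t, y s j := by
    intro t ht j
    rw [hq t ht, Pi.smul_apply, smul_eq_mul]
    congr 1
    exact ((ContinuousLinearMap.proj (R := ℝ) (φ := fun _ : Fin (n + 1) => ℝ)
      j).intervalIntegral_comp_comm (hyi 0 t)).symm
  set g : ℝ → Fin (m + 1) → ℝ := fun t i => ∑ j, A i j * y t j with hg
  have hAq : ∀ t > (0:ℝ), ∀ i, ∑ j, A i j * q t j = (1 / t) * ∫ s in (0:ℝ)..t, g s i := by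
    intro t ht i
    simp only [hg]
    rw [intervalIntegral.integral_finsetSum fun j _ => (hyji j 0 t).const_mul (A i j),
      Finset.mul_sum]
    refine Finset.sum_congr rfl fun j _ => ?_
    rw [intervalIntegral.integral_const_mul, hqj t ht j]
    ring
  have hcore := fp_core g x (∑ i, ∑ j, |A i j|) ?_ ?_ ?_ hx ?_
  · refine hcore.congr' ?_
    filter_upwards [eventually_gt_atTop (0:ℝ)] with T hT
    congr 1
    · congr 2
      funext t
      simp only [hg, Finset.mul_sum, mul_assoc]
    · unfold Abar
      simp only [hAq T hT]
      exact Finset.mul₀_sup' (by positivity) _ _ _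
  · intro i
    exact Finset.measurable_sum _ fun j _ =>
      ((measurable_pi_apply j).comp hymeas).const_mul (A i j)
  · exact fun i => (measurable_pi_apply i).comp hxmeas
  · intro t i
    calc |g t i| ≤ ∑ j, |A i j * y t j| := Finset.abs_sum_le_sum_abs _ _
      _ ≤ ∑ j, |A i j| := by
          refine Finset.sum_le_sum fun j _ => ?_
          rw [abs_mul]
          exact mul_le_of_le_one_right (abs_nonneg _) (hy1 t j)
      _ ≤ _ := Finset.single_le_sum (f := fun i => ∑ j, |A i j|)
          (fun k _ => Finset.sum_nonneg fun j _ => abs_nonneg _) (Finset.mem_univ i)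
  · intro t ht i
    have ht0 : (0:ℝ) < t := by linarith
    have h1 := hBRA t ht _ (single_mem_stdSimplex ℝ i)
    simp only [mul_assoc, ← Finset.mul_sum, hAq t ht0] at h1
    simp only [Pi.single_apply, ite_mul, one_mul, zero_mul, Finset.sum_ite_eq', Finset.mem_univ,
      if_true] at h1
    have h2 : ∑ k, x t k * (1 / t * ∫ s in (0:ℝ)..t, g s k)
        = (1 / t) * ∑ k, x t k * ∫ s in (0:ℝ)..t, g s k := by
      rw [Finset.mul_sum]
      exact Finset.sum_congr rfl fun k _ => by ring
    rw [h2] at h1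
    exact le_of_mul_le_mul_left h1 (by positivity)

/-- along any continuous-time fictitious play orbit, the difference between the
time-averaged realized payoff and the current best-response payoff vanishes, for both players. -/
theorem fp_belief_affirming {m n : ℕ}
    (A B : Matrix (Fin (m + 1)) (Fin (n + 1)) ℝ)
    (x : ℝ → Fin (m + 1) → ℝ) (y : ℝ → Fin (n + 1) → ℝ)
    (hxmeas : Measurable x) (hymeas : Measurable y)
    (hx : ∀ t, x t ∈ stdSimplex ℝ (Fin (m + 1)))
    (hy : ∀ t, y t ∈ stdSimplex ℝ (Fin (n + 1)))
    (p : ℝ → Fin (m + 1) → ℝ) (q : ℝ → Fin (n + 1) → ℝ)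
    (hp : ∀ t > (0:ℝ), p t = (1 / t) • ∫ s in (0:ℝ)..t, x s)
    (hq : ∀ t > (0:ℝ), q t = (1 / t) • ∫ s in (0:ℝ)..t, y s)
    (hBRA : ∀ t ≥ (1:ℝ), ∀ p' ∈ stdSimplex ℝ (Fin (m + 1)),
      ∑ i, ∑ j, p' i * A i j * q t j ≤ ∑ i, ∑ j, x t i * A i j * q t j)
    (hBRB : ∀ t ≥ (1:ℝ), ∀ q' ∈ stdSimplex ℝ (Fin (n + 1)),
      ∑ i, ∑ j, p t i * B i j * q' j ≤ ∑ i, ∑ j, p t i * B i j * y t j) :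
    Tendsto (fun T : ℝ =>
        (1 / T) * (∫ t in (0:ℝ)..T, ∑ i, ∑ j, x t i * A i j * y t j) - Abar A (q T))
      atTop (𝓝 0) ∧
    Tendsto (fun T : ℝ =>
        (1 / T) * (∫ t in (0:ℝ)..T, ∑ i, ∑ j, x t i * B i j * y t j) - Bbar B (p T))
      atTop (𝓝 0) := by
  refine ⟨fp_player A x y hxmeas hymeas hx hy q hq hBRA, ?_⟩
  have h := fp_player B.transpose y x hymeas hxmeas hy hx p hp ?_
  · refine h.congr fun T => ?_
    congr 1
    · congr 2
      funext t
      rw [Finset.sum_comm]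
      refine Finset.sum_congr rfl fun i _ => Finset.sum_congr rfl fun j _ => ?_
      rw [Matrix.transpose_apply]
      ring
    · simp only [Abar, Bbar, Matrix.transpose_apply, mul_comm]
  · intro t ht q' hq'
    have key : ∀ v : Fin (n + 1) → ℝ, ∑ j, ∑ i, v j * B.transpose j i * p t i
        = ∑ i, ∑ j, p t i * B i j * v j := by
      intro v
      rw [Finset.sum_comm]
      refine Finset.sum_congr rfl fun i _ => Finset.sum_congr rfl fun j _ => ?_
      rw [Matrix.transpose_apply]
      ring
    rw [key, key]
    exact hBRB t ht q' hq'
end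

section
/- Every trajectory of continuous-time fictitious play in a bimatrix game converges to the set of coarse correlated equilibria: the empirical joint distribution P(T) with p_{ij}(T) = (1/T)∫_0^T x_i(t)y_j(t)dt satisfies lim_{T→∞} ( Σ_{i,j} a_{ij} p_{ij}(T) − max_{i'} Σ_{i,j} a_{i'j} p_{ij}(T) ) = 0 and lim_{T→∞} ( Σ_{i,j} b_{ij} p_{ij}(T) − max_{j'} Σ_{i,j} b_{ij'} p_{ij}(T) ) = 0; in particular every limit point of P(T) is a coarse correlated equilibrium. -/
open Filter
open scoped BigOperators Topology

/-- A joint distribution `P` is a coarse correlated equilibrium of `(A,B)`. -/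
def IsCCE {m n : ℕ} (A B : Matrix (Fin (m + 1)) (Fin (n + 1)) ℝ)
    (P : Fin (m + 1) → Fin (n + 1) → ℝ) : Prop :=
  (∀ i', ∑ i, ∑ j, A i' j * P i j ≤ ∑ i, ∑ j, A i j * P i j) ∧
  (∀ j', ∑ i, ∑ j, B i j' * P i j ≤ ∑ i, ∑ j, B i j * P i j)

section FPHelpers
open MeasureTheory

theorem fp_intervalIntegrable_of_bdd {f : ℝ → ℝ} {K : ℝ} (hf : Measurable f)
    (hK : ∀ t, |f t| ≤ K) (a b : ℝ) : IntervalIntegrable f volume a b := by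
  refine (intervalIntegrable_const (c := K)).mono_fun hf.aestronglyMeasurable ?_
  filter_upwards with t
  exact (hK t).trans (le_abs_self K)

theorem fp_ii_sum {ι : Type*} [Fintype ι] {f : ι → ℝ → ℝ} {a b : ℝ}
    (h : ∀ i ∈ Finset.univ, IntervalIntegrable (f i) volume a b) :
    IntervalIntegrable (fun t => ∑ i, f i t) volume a b := by
  have := IntervalIntegrable.sum Finset.univ h
  have e : (fun t => ∑ i, f i t) = ∑ i, f i := by
    funext t
    simp
  rw [e]
  exact this

theorem fp_core_s9 {ι : Type*} [Fintype ι] [Nonempty ι] (v w : ℝ → ι → ℝ) (K : ℝ) (hK0 : 0 ≤ K)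
    (hv : ∀ i, Measurable fun t => v t i) (hw : ∀ i, Measurable fun t => w t i)
    (hvK : ∀ t i, |v t i| ≤ K) (hws : ∀ t, w t ∈ stdSimplex ℝ ι)
    (hbr : ∀ t ≥ (1:ℝ), ∀ i, ∫ s in (0:ℝ)..t, v s i ≤ ∑ k, w t k * ∫ s in (0:ℝ)..t, v s k)
    (T : ℝ) (hT : 1 ≤ T) :
    ∫ t in (1:ℝ)..T, ∑ k, w t k * v t k =
      Finset.univ.sup' Finset.univ_nonempty (fun i => ∫ s in (0:ℝ)..T, v s i) -
      Finset.univ.sup' Finset.univ_nonempty (fun i => ∫ s in (0:ℝ)..1, v s i) := by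
  have hint : ∀ i a b, IntervalIntegrable (fun t => v t i) volume a b := fun i a b =>
    fp_intervalIntegrable_of_bdd (hv i) (fun t => hvK t i) a b
  set M : ℝ → ℝ := fun t =>
    Finset.univ.sup' Finset.univ_nonempty (fun i => ∫ s in (0:ℝ)..t, v s i) with hM
  have hUM : ∀ t i, ∫ s in (0:ℝ)..t, v s i ≤ M t := fun t i =>
    Finset.le_sup' (fun i => ∫ s in (0:ℝ)..t, v s i) (Finset.mem_univ i)
  have hwM : ∀ s t, ∑ k, w s k * ∫ r in (0:ℝ)..t, v r k ≤ M t := by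
    intro s t
    calc ∑ k, w s k * ∫ r in (0:ℝ)..t, v r k ≤ ∑ k, w s k * M t :=
          Finset.sum_le_sum fun k _ => mul_le_mul_of_nonneg_left (hUM t k) ((hws s).1 k)
      _ = M t := by rw [← Finset.sum_mul, (hws s).2, one_mul]
  have hLip : LipschitzWith K.toNNReal M := by
    refine LipschitzWith.of_le_add_mul _ fun a b => ?_
    rw [Real.coe_toNNReal K hK0]
    refine Finset.sup'_le _ _ fun i _ => ?_
    have h1 : (∫ s in (0:ℝ)..a, v s i) - ∫ s in (0:ℝ)..b, v s i = ∫ s in b..a, v s i :=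
      intervalIntegral.integral_interval_sub_left (hint i _ _) (hint i _ _)
    have h2 : ‖∫ s in b..a, v s i‖ ≤ K * |a - b| :=
      intervalIntegral.norm_integral_le_of_norm_le_const fun s _ => hvK s i
    have h3 := (le_abs_self _).trans h2
    have h4 := hUM b i
    rw [Real.dist_eq]
    linarith
  have hAC : AbsolutelyContinuousOnInterval M 1 T :=
    (hLip.lipschitzOnWith (s := Set.uIcc 1 T)).absolutelyContinuousOnInterval
  change _ = M T - M 1
  rw [← hAC.integral_deriv_eq_sub]
  apply intervalIntegral.integral_congr_ae
  have hLD : ∀ᵐ t : ℝ, ∀ i, HasDerivAt (fun t => ∫ s in (0:ℝ)..t, v s i) (v t i) t := by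
    rw [ae_all_iff]
    intro i
    have : LocallyIntegrable (fun t => v t i) volume := by
      intro t
      refine ⟨Set.Icc (t-1) (t+1), Icc_mem_nhds (by linarith) (by linarith), ?_⟩
      rw [← intervalIntegrable_iff_integrableOn_Icc_of_le (by linarith)]
      exact hint i _ _
    filter_upwards [LocallyIntegrable.ae_hasDerivAt_integral this] with t ht
    exact ht 0
  filter_upwards [hLD, hAC.ae_differentiableAt] with t ht hd htm
  have hdM := (hd (Set.uIoc_subset_uIcc htm)).hasDerivAt
  rw [Set.uIoc_of_le hT] at htm
  have hdw : HasDerivAt (fun s => ∑ k, w t k * ∫ r in (0:ℝ)..s, v r k)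
      (∑ k, w t k * v t k) t :=
    HasDerivAt.fun_sum fun k _ => (ht k).const_mul (w t k)
  have hdiff := hdM.fun_sub hdw
  have hmin : IsLocalMin (fun s => M s - ∑ k, w t k * ∫ r in (0:ℝ)..s, v r k) t := by
    filter_upwards with s
    have h1 := hwM t s
    have h2 : M t ≤ ∑ k, w t k * ∫ r in (0:ℝ)..t, v r k :=
      Finset.sup'_le _ _ fun i _ => hbr t htm.1.le i
    linarith
  have := hmin.hasDerivAt_eq_zero hdiff
  linarith

theorem fp_player_s9 {ι κ : Type*} [Fintype ι] [Nonempty ι] [Fintype κ]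
    (G : ι → κ → ℝ) (w : ℝ → ι → ℝ) (z : ℝ → κ → ℝ)
    (hw : Measurable w) (hz : Measurable z)
    (hws : ∀ t, w t ∈ stdSimplex ℝ ι) (hzs : ∀ t, z t ∈ stdSimplex ℝ κ)
    (r : ℝ → κ → ℝ) (hr : ∀ t > (0:ℝ), r t = (1 / t) • ∫ s in (0:ℝ)..t, z s)
    (hbr : ∀ t ≥ (1:ℝ), ∀ i, ∑ l, G i l * r t l ≤ ∑ k, w t k * ∑ l, G k l * r t l)
    (Q : ℝ → ι → κ → ℝ)
    (hQ : ∀ T > (0:ℝ), ∀ i j, Q T i j = (1 / T) * ∫ t in (0:ℝ)..T, w t i * z t j) :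
    Tendsto (fun T : ℝ => ∑ i, ∑ j, G i j * Q T i j -
        Finset.univ.sup' Finset.univ_nonempty (fun i' => ∑ i, ∑ j, G i' j * Q T i j))
      atTop (𝓝 0) := by
  have hwm : ∀ i, Measurable fun t => w t i := fun i => (measurable_pi_apply i).comp hw
  have hzm : ∀ i, Measurable fun t => z t i := fun i => (measurable_pi_apply i).comp hz
  have hwb : ∀ t i, |w t i| ≤ 1 := fun t i => by
    rw [abs_of_nonneg ((hws t).1 i), ← (hws t).2]
    exact Finset.single_le_sum (fun k _ => (hws t).1 k) (Finset.mem_univ i)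
  have hzb : ∀ t i, |z t i| ≤ 1 := fun t i => by
    rw [abs_of_nonneg ((hzs t).1 i), ← (hzs t).2]
    exact Finset.single_le_sum (fun k _ => (hzs t).1 k) (Finset.mem_univ i)
  have hzi : ∀ j a b, IntervalIntegrable (fun t => z t j) volume a b := fun j a b =>
    fp_intervalIntegrable_of_bdd (hzm j) (fun t => hzb t j) a b
  have hwzi : ∀ i j a b, IntervalIntegrable (fun t => w t i * z t j) volume a b :=
    fun i j a b => fp_intervalIntegrable_of_bdd (K := 1) ((hwm i).mul (hzm j)) (fun t => by
      rw [Pi.mul_apply, abs_mul]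
      exact mul_le_one₀ (hwb t i) (abs_nonneg _) (hzb t j)) a b
  set v : ℝ → ι → ℝ := fun t i => ∑ l, G i l * z t l with hv
  have hvm : ∀ i, Measurable fun t => v t i := fun i =>
    Finset.measurable_sum _ fun l _ => (hzm l).const_mul (G i l)
  set K : ℝ := ∑ i, ∑ l, |G i l| with hK
  have hK0 : 0 ≤ K := Finset.sum_nonneg fun i _ => Finset.sum_nonneg fun l _ => abs_nonneg _
  have hvK : ∀ t i, |v t i| ≤ K := by
    intro t i
    calc |v t i| ≤ ∑ l, |G i l * z t l| := Finset.abs_sum_le_sum_abs _ _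
      _ ≤ ∑ l, |G i l| := Finset.sum_le_sum fun l _ => by
          rw [abs_mul]; exact mul_le_of_le_one_right (abs_nonneg _) (hzb t l)
      _ ≤ K := Finset.single_le_sum (f := fun i => ∑ l, |G i l|)
          (fun i _ => Finset.sum_nonneg fun l _ => abs_nonneg _) (Finset.mem_univ i)
  have hU : ∀ t i, ∫ s in (0:ℝ)..t, v s i = ∑ l, G i l * ∫ s in (0:ℝ)..t, z s l := by
    intro t i
    rw [hv]
    simp only
    rw [intervalIntegral.integral_finsetSum fun l _ => (hzi l _ _).const_mul _]
    simp only [intervalIntegral.integral_const_mul]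
  have hzv : ∀ t, IntervalIntegrable z volume 0 t := by
    intro t
    refine (intervalIntegrable_const (c := (1:ℝ))).mono_fun hz.aestronglyMeasurable ?_
    filter_upwards with s
    rw [norm_one]
    exact (pi_norm_le_iff_of_nonneg zero_le_one).2 fun i => hzb s i
  have hrl : ∀ t > (0:ℝ), ∀ l, r t l = (1 / t) * ∫ s in (0:ℝ)..t, z s l := by
    intro t ht l
    rw [hr t ht, Pi.smul_apply, smul_eq_mul]
    congr 1
    exact ((ContinuousLinearMap.proj (R := ℝ) (φ := fun _ : κ => ℝ) l).intervalIntegral_comp_comm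
      (hzv t)).symm
  have hrU : ∀ t > (0:ℝ), ∀ i, ∑ l, G i l * r t l = (1 / t) * ∫ s in (0:ℝ)..t, v s i := by
    intro t ht i
    rw [hU, Finset.mul_sum]
    refine Finset.sum_congr rfl fun l _ => ?_
    rw [hrl t ht]; ring
  have hbr' : ∀ t ≥ (1:ℝ), ∀ i,
      ∫ s in (0:ℝ)..t, v s i ≤ ∑ k, w t k * ∫ s in (0:ℝ)..t, v s k := by
    intro t ht i
    have ht0 : 0 < t := by linarith
    have h := hbr t ht i
    simp only [hrU t ht0] at h
    have h2 : ∑ k, w t k * (1 / t * ∫ s in (0:ℝ)..t, v s k)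
        = (1 / t) * ∑ k, w t k * ∫ s in (0:ℝ)..t, v s k := by
      rw [Finset.mul_sum]
      exact Finset.sum_congr rfl fun k _ => by ring
    rw [h2] at h
    exact le_of_mul_le_mul_left h (by positivity)
  have hcore := fp_core_s9 v w K hK0 hvm hwm hvK hws hbr'
  have hwvi : ∀ a b, IntervalIntegrable (fun t => ∑ k, w t k * v t k) volume a b := by
    intro a b
    have : (fun t => ∑ k, w t k * v t k) = fun t => ∑ k, ∑ l, G k l * (w t k * z t l) := by
      funext t
      refine Finset.sum_congr rfl fun k _ => ?_
      rw [hv, Finset.mul_sum]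
      exact Finset.sum_congr rfl fun l _ => by ring
    rw [this]
    exact fp_ii_sum fun k _ => fp_ii_sum fun l _ =>
      (hwzi k l a b).const_mul _
  set C : ℝ := (∫ t in (0:ℝ)..1, ∑ k, w t k * v t k) -
    Finset.univ.sup' Finset.univ_nonempty (fun i => ∫ s in (0:ℝ)..1, v s i) with hC
  have hlim : Tendsto (fun T : ℝ => C * T⁻¹) atTop (𝓝 0) := by
    simpa using tendsto_inv_atTop_zero.const_mul C
  refine hlim.congr' ?_
  filter_upwards [eventually_ge_atTop (1:ℝ)] with T hT
  have hT0 : 0 < T := by linarith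
  have e1 : ∑ i, ∑ j, G i j * Q T i j = (1 / T) * ∫ t in (0:ℝ)..T, ∑ k, w t k * v t k := by
    have : (fun t => ∑ k, w t k * v t k) = fun t => ∑ k, ∑ l, G k l * (w t k * z t l) := by
      funext t
      refine Finset.sum_congr rfl fun k _ => ?_
      rw [hv, Finset.mul_sum]
      exact Finset.sum_congr rfl fun l _ => by ring
    rw [this, intervalIntegral.integral_finsetSum fun k _ => fp_ii_sum
      fun l _ => (hwzi k l _ _).const_mul _, Finset.mul_sum]
    refine Finset.sum_congr rfl fun k _ => ?_
    rw [intervalIntegral.integral_finsetSum fun l _ => (hwzi k l _ _).const_mul _, Finset.mul_sum]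
    refine Finset.sum_congr rfl fun l _ => ?_
    rw [hQ T hT0, intervalIntegral.integral_const_mul]; ring
  have e2 : ∀ i', ∑ i, ∑ j, G i' j * Q T i j = (1 / T) * ∫ s in (0:ℝ)..T, v s i' := by
    intro i'
    rw [Finset.sum_comm, hU, Finset.mul_sum]
    refine Finset.sum_congr rfl fun l _ => ?_
    rw [← Finset.mul_sum]
    have : ∑ i, Q T i l = (1 / T) * ∫ s in (0:ℝ)..T, z s l := by
      simp only [hQ T hT0]
      rw [← Finset.mul_sum, ← intervalIntegral.integral_finsetSum fun k _ => hwzi k l _ _]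
      simp only [← Finset.sum_mul, (hws _).2, one_mul]
    rw [this]; ring
  have e3 : Finset.univ.sup' Finset.univ_nonempty (fun i' => ∑ i, ∑ j, G i' j * Q T i j)
      = (1 / T) * Finset.univ.sup' Finset.univ_nonempty (fun i => ∫ s in (0:ℝ)..T, v s i) := by
    simp only [e2]
    rw [Finset.mul₀_sup' (by positivity)]
  rw [e1, e3, hC]
  have h1 := hcore T hT
  have h2 := intervalIntegral.integral_add_adjacent_intervals (hwvi 0 1) (hwvi 1 T)
  rw [← h2, h1]
  ring

theorem fp_cluster {X ι : Type*} [TopologicalSpace X] [Fintype ι] [Nonempty ι] (f : X → ℝ)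
    (hf : Continuous f) (g : ι → X → ℝ) (hg : ∀ i, Continuous (g i)) (P : ℝ → X) (P₀ : X)
    (h : Tendsto (fun T => f (P T) -
      Finset.univ.sup' Finset.univ_nonempty (fun i => g i (P T))) atTop (𝓝 0))
    (hP : MapClusterPt P₀ atTop P) (i : ι) : g i P₀ ≤ f P₀ := by
  have hc : Continuous fun x => f x - Finset.univ.sup' Finset.univ_nonempty (fun i => g i x) :=
    hf.sub (Continuous.finset_sup'_apply _ fun i _ => hg i)
  have h1 := hP.continuousAt_comp hc.continuousAt
  have h2 : f P₀ - Finset.univ.sup' Finset.univ_nonempty (fun i => g i P₀) = 0 := by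
    have : ClusterPt _ _ := h1
    have h3 := this.mono h
    by_contra hne
    exact NeBot.ne h3 (disjoint_iff.1 (disjoint_nhds_nhds.2 hne))
  have h4 := Finset.le_sup' (fun i => g i P₀) (Finset.mem_univ i)
  linarith

end FPHelpers

/-- every fictitious play trajectory converges to the set of coarse correlated
equilibria: the regrets of both players vanish asymptotically, and every limit point of the
empirical joint distribution is a CCE. -/
theorem fp_converges_to_cce {m n : ℕ}
    (A B : Matrix (Fin (m + 1)) (Fin (n + 1)) ℝ)
    (x : ℝ → Fin (m + 1) → ℝ) (y : ℝ → Fin (n + 1) → ℝ)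
    (hxmeas : Measurable x) (hymeas : Measurable y)
    (hx : ∀ t, x t ∈ stdSimplex ℝ (Fin (m + 1)))
    (hy : ∀ t, y t ∈ stdSimplex ℝ (Fin (n + 1)))
    (p : ℝ → Fin (m + 1) → ℝ) (q : ℝ → Fin (n + 1) → ℝ)
    (hp : ∀ t > (0:ℝ), p t = (1 / t) • ∫ s in (0:ℝ)..t, x s)
    (hq : ∀ t > (0:ℝ), q t = (1 / t) • ∫ s in (0:ℝ)..t, y s)
    (hBRA : ∀ t ≥ (1:ℝ), ∀ p' ∈ stdSimplex ℝ (Fin (m + 1)),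
      ∑ i, ∑ j, p' i * A i j * q t j ≤ ∑ i, ∑ j, x t i * A i j * q t j)
    (hBRB : ∀ t ≥ (1:ℝ), ∀ q' ∈ stdSimplex ℝ (Fin (n + 1)),
      ∑ i, ∑ j, p t i * B i j * q' j ≤ ∑ i, ∑ j, p t i * B i j * y t j)
    -- the empirical joint distribution of play
    (P : ℝ → Fin (m + 1) → Fin (n + 1) → ℝ)
    (hP : ∀ T > (0:ℝ), ∀ i j, P T i j = (1 / T) * ∫ t in (0:ℝ)..T, x t i * y t j) :
    (Tendsto (fun T : ℝ => ∑ i, ∑ j, A i j * P T i j -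
        Finset.univ.sup' Finset.univ_nonempty (fun i' => ∑ i, ∑ j, A i' j * P T i j))
      atTop (𝓝 0)) ∧
    (Tendsto (fun T : ℝ => ∑ i, ∑ j, B i j * P T i j -
        Finset.univ.sup' Finset.univ_nonempty (fun j' => ∑ i, ∑ j, B i j' * P T i j))
      atTop (𝓝 0)) ∧
    (∀ P₀ : Fin (m + 1) → Fin (n + 1) → ℝ, MapClusterPt P₀ atTop P → IsCCE A B P₀) := by
  have hA : Tendsto (fun T : ℝ => ∑ i, ∑ j, A i j * P T i j -
        Finset.univ.sup' Finset.univ_nonempty (fun i' => ∑ i, ∑ j, A i' j * P T i j))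
      atTop (𝓝 0) := by
    refine fp_player_s9 A x y hxmeas hymeas hx hy q hq (fun t ht i => ?_) P hP
    have h := hBRA t ht (Pi.single i 1) (single_mem_stdSimplex ℝ i)
    simpa [Pi.single_apply, Finset.mul_sum, mul_assoc] using h
  have hB : Tendsto (fun T : ℝ => ∑ i, ∑ j, B i j * P T i j -
        Finset.univ.sup' Finset.univ_nonempty (fun j' => ∑ i, ∑ j, B i j' * P T i j))
      atTop (𝓝 0) := by
    have h := fp_player_s9 (fun j i => B i j) y x hymeas hxmeas hy hx p hp (fun t ht j => by
      have h := hBRB t ht (Pi.single j 1) (single_mem_stdSimplex ℝ j)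
      have e : ∑ k, y t k * ∑ l, B l k * p t l = ∑ i, ∑ j, p t i * B i j * y t j := by
        rw [Finset.sum_comm]
        refine Finset.sum_congr rfl fun k _ => ?_
        rw [Finset.mul_sum]
        exact Finset.sum_congr rfl fun l _ => by ring
      rw [e]
      simpa [Pi.single_apply, mul_comm] using h) (fun T j i => P T i j)
      (fun T hT j i => by
        rw [hP T hT]
        simp only [mul_comm])
    refine h.congr fun T => ?_
    congr 1
    · exact Finset.sum_comm
    · congr 1
      funext j'
      exact Finset.sum_comm
  refine ⟨hA, hB, fun P₀ hP₀ => ⟨fun i' => ?_, fun j' => ?_⟩⟩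
  · exact fp_cluster (fun P : Fin (m + 1) → Fin (n + 1) → ℝ => ∑ i, ∑ j, A i j * P i j)
      (by fun_prop) (fun i' P => ∑ i, ∑ j, A i' j * P i j) (fun i => by fun_prop) P P₀ hA hP₀ i'
  · exact fp_cluster (fun P : Fin (m + 1) → Fin (n + 1) → ℝ => ∑ i, ∑ j, B i j * P i j)
      (by fun_prop) (fun j' P => ∑ i, ∑ j, B i j' * P i j) (fun i => by fun_prop) P P₀ hB hP₀ j'
end
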